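/- arXiv:1206.3193 — 2 statements merged into one kernel-verified Lean document; each statement's English description precedes it below -/
import Mathlib

section
/- Let W be a subset of the vertex set of T_{L,d} satisfying W∩O = ∂_ext(W∩E), i.e., the odd part of W is exactly the set of vertices outside W∩E having a neighbor in W∩E. Then the edge boundary of W satisfies |∇(W)| = 2d( |W∩O| − |W∩E| ). -/
open Finset

/-- Vertices of the discrete torus `T_{L,d}`: functions from `Fin d` to `Fin L`. -/
abbrev TV (L d : ℕ) : Type := Fin d → Fin L

/-- Adjacency in the discrete torus `T_{L,d}`: `x` and `y` differ in exactly one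
coordinate, and differ by `1 (mod L)` in that coordinate. -/
def TorusAdj {L d : ℕ} (x y : TV L d) : Prop :=
  ∃ i : Fin d, x i ≠ y i ∧
    ((y i : ℕ) = ((x i : ℕ) + 1) % L ∨ (x i : ℕ) = ((y i : ℕ) + 1) % L) ∧
    ∀ j : Fin d, j ≠ i → x j = y j

instance {L d : ℕ} (x y : TV L d) : Decidable (TorusAdj x y) := by
  unfold TorusAdj; infer_instance

/-- A vertex of the torus is even if its coordinate sum is even. -/
def IsEvenVtx {L d : ℕ} (x : TV L d) : Prop := (∑ i, (x i : ℕ)) % 2 = 0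

instance {L d : ℕ} (x : TV L d) : Decidable (IsEvenVtx x) := by
  unfold IsEvenVtx; infer_instance

/-- Proper 3-colorings of `T_{L,d}`. -/
def ProperColoring (L d : ℕ) (χ : TV L d → Fin 3) : Prop :=
  ∀ x y : TV L d, TorusAdj x y → χ x ≠ χ y

instance (L d : ℕ) : DecidablePred (ProperColoring L d) := by
  intro χ; unfold ProperColoring; infer_instance

/-- The set (as a type) of proper 3-colorings of `T_{L,d}`. -/
abbrev Coloring3 (L d : ℕ) : Type := {χ : TV L d → Fin 3 // ProperColoring L d χ}

/-- `|χ⁻¹(0) ∩ E|`: the number of even vertices colored 0. -/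
noncomputable def zeroEvenCount (L d : ℕ) (χ : TV L d → Fin 3) : ℕ :=
  Nat.card {v : TV L d // χ v = 0 ∧ IsEvenVtx v}

/-- `|χ⁻¹(0) ∩ O|`: the number of odd vertices colored 0. -/
noncomputable def zeroOddCount (L d : ℕ) (χ : TV L d → Fin 3) : ℕ :=
  Nat.card {v : TV L d // χ v = 0 ∧ ¬ IsEvenVtx v}

/-- Balanced colorings: `||χ⁻¹(0)∩E| - |χ⁻¹(0)∩O|| ≤ ρ L^d / 2`. -/
def BalancedColoring (L d : ℕ) (ρ : ℝ) (χ : TV L d → Fin 3) : Prop :=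
  |(zeroEvenCount L d χ : ℝ) - (zeroOddCount L d χ : ℝ)| ≤ ρ * (L : ℝ) ^ d / 2

/-- Colorings where color 0 predominates on the even sublattice:
`|χ⁻¹(0)∩E| > |χ⁻¹(0)∩O| + ρ L^d / 2`. -/
def EvenMajorityColoring (L d : ℕ) (ρ : ℝ) (χ : TV L d → Fin 3) : Prop :=
  (zeroOddCount L d χ : ℝ) + ρ * (L : ℝ) ^ d / 2 < (zeroEvenCount L d χ : ℝ)

/-- The uniform measure, on proper 3-colorings of `T_{L,d}`, of the set of proper
3-colorings satisfying the predicate `P`. -/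
noncomputable def pi3 (L d : ℕ) (P : (TV L d → Fin 3) → Prop) : ℝ :=
  (Nat.card {χ : TV L d → Fin 3 // ProperColoring L d χ ∧ P χ} : ℝ) /
    (Nat.card (Coloring3 L d) : ℝ)

/-- The binary entropy function `H(x) = -x log₂ x - (1-x) log₂ (1-x)`. -/
noncomputable def binEntropy (x : ℝ) : ℝ :=
  -(x * Real.logb 2 x) - (1 - x) * Real.logb 2 (1 - x)

/-- External vertex boundary `∂_ext X`. -/
def extBdry {L d : ℕ} (X : Set (TV L d)) : Set (TV L d) :=
  {y | y ∉ X ∧ ∃ x ∈ X, TorusAdj y x}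

/-- Internal vertex boundary `∂_int X`. -/
def intBdry {L d : ℕ} (X : Set (TV L d)) : Set (TV L d) :=
  {x | x ∈ X ∧ ∃ y, y ∉ X ∧ TorusAdj x y}

/-- The even part `W ∩ E`. -/
def evenPart {L d : ℕ} (W : Set (TV L d)) : Set (TV L d) := {v ∈ W | IsEvenVtx v}

/-- The odd part `W ∩ O`. -/
def oddPart {L d : ℕ} (W : Set (TV L d)) : Set (TV L d) := {v ∈ W | ¬ IsEvenVtx v}

/-- The size `|∇(W)|` of the edge boundary of `W`: each boundary edge is counted once,
as the ordered pair whose first coordinate is inside `W`. -/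
noncomputable def cutsetCard (L d : ℕ) (W : Set (TV L d)) : ℕ :=
  Nat.card {p : TV L d × TV L d // p.1 ∈ W ∧ p.2 ∉ W ∧ TorusAdj p.1 p.2}

/-- The forward (`true`) or backward (`false`) cyclic shift of a residue modulo `L`. -/
def cyclicShift {L : ℕ} (a : Fin L) (b : Bool) : Fin L :=
  ⟨if b then ((a : ℕ) + 1) % L else ((a : ℕ) + (L - 1)) % L, by
    have := a.pos
    split <;> exact Nat.mod_lt _ this⟩

lemma add_one_mod_cases {L : ℕ} (a : Fin L) :
    ((a : ℕ) + 1 < L ∧ ((a : ℕ) + 1) % L = a + 1) ∨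
      ((a : ℕ) + 1 = L ∧ ((a : ℕ) + 1) % L = 0) := by
  rcases Nat.lt_or_ge ((a : ℕ) + 1) L with h | h
  · exact Or.inl ⟨h, Nat.mod_eq_of_lt h⟩
  · have h' : (a : ℕ) + 1 = L := by omega
    exact Or.inr ⟨h', by rw [h', Nat.mod_self]⟩

lemma add_pred_mod_cases {L : ℕ} (a : Fin L) :
    (0 < (a : ℕ) ∧ ((a : ℕ) + (L - 1)) % L = a - 1) ∨
      ((a : ℕ) = 0 ∧ ((a : ℕ) + (L - 1)) % L = L - 1) := by
  have ha := a.isLt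
  rcases Nat.eq_zero_or_pos (a : ℕ) with h | h
  · exact Or.inr ⟨h, by rw [h, Nat.zero_add, Nat.mod_eq_of_lt (by omega)]⟩
  · refine Or.inl ⟨h, ?_⟩
    rw [show (a : ℕ) + (L - 1) = (a - 1) + L by omega, Nat.add_mod_right,
      Nat.mod_eq_of_lt (by omega)]

lemma cyclicShift_ne {L : ℕ} (hL : 2 ≤ L) (a : Fin L) (b : Bool) : cyclicShift a b ≠ a := by
  intro h
  have h := congrArg Fin.val h
  have h1 := add_one_mod_cases a
  have h2 := add_pred_mod_cases a
  cases b <;> simp only [cyclicShift, if_true, Bool.false_eq_true, if_false] at h <;> omega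

lemma cyclicShift_injective {L : ℕ} (hL : 3 ≤ L) (a : Fin L) :
    Function.Injective (cyclicShift a) := by
  intro b c h
  have h := congrArg Fin.val h
  have h1 := add_one_mod_cases a
  have h2 := add_pred_mod_cases a
  cases b <;> cases c <;>
    simp only [cyclicShift, if_true, Bool.false_eq_true, if_false] at h ⊢ <;> omega

lemma exists_cyclicShift_eq_iff {L : ℕ} (a c : Fin L) :
    (∃ b, cyclicShift a b = c) ↔
      ((c : ℕ) = ((a : ℕ) + 1) % L ∨ (a : ℕ) = ((c : ℕ) + 1) % L) := by
  have h1 := add_one_mod_cases a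
  have h2 := add_pred_mod_cases a
  have h3 := add_one_mod_cases c
  have ha := a.isLt
  have hc := c.isLt
  simp only [Bool.exists_bool, cyclicShift, Fin.ext_iff, if_true, Bool.false_eq_true, if_false]
  omega

lemma TorusAdj.symm {L d : ℕ} {x y : TV L d} (h : TorusAdj x y) : TorusAdj y x := by
  obtain ⟨i, hne, h, hj⟩ := h
  exact ⟨i, hne.symm, h.symm, fun j hji => (hj j hji).symm⟩

/-- In an even torus, adjacent vertices have opposite parity. -/
lemma TorusAdj.isEvenVtx_iff {L d : ℕ} (hL : Even L) {x y : TV L d} (h : TorusAdj x y) :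
    IsEvenVtx x ↔ ¬ IsEvenVtx y := by
  obtain ⟨i, -, h, hj⟩ := h
  have hs : ∑ j ∈ univ.erase i, (x j : ℕ) = ∑ j ∈ univ.erase i, (y j : ℕ) :=
    sum_congr rfl fun j hji => by rw [hj j (ne_of_mem_erase hji)]
  unfold IsEvenVtx
  rw [← add_sum_erase univ (fun j => (x j : ℕ)) (mem_univ i),
    ← add_sum_erase univ (fun j => (y j : ℕ)) (mem_univ i), hs]
  have h1 := add_one_mod_cases (x i)
  have h2 := add_one_mod_cases (y i)
  obtain ⟨k, hk⟩ := hL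
  omega

/-- The torus `T_{L,d}` is `2d`-regular. -/
lemma card_filter_torusAdj {L d : ℕ} (hL : 3 ≤ L) (x : TV L d) :
    #{y | TorusAdj x y} = 2 * d := by
  have himage : ({y | TorusAdj x y} : Finset (TV L d)) =
      univ.image fun p : Fin d × Bool => Function.update x p.1 (cyclicShift (x p.1) p.2) := by
    ext y
    simp only [mem_filter, mem_univ, true_and, mem_image, Prod.exists]
    constructor
    · rintro ⟨i, -, h, hj⟩
      obtain ⟨b, hb⟩ := (exists_cyclicShift_eq_iff _ _).2 h
      exact ⟨i, b, Function.update_eq_iff.2 ⟨hb, hj⟩⟩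
    · rintro ⟨i, b, rfl⟩
      refine ⟨i, ?_, (exists_cyclicShift_eq_iff _ _).1 ⟨b, by simp⟩, fun j hji => by simp [hji]⟩
      simpa using (cyclicShift_ne (by omega) (x i) b).symm
  rw [himage, card_image_of_injective, card_univ, Fintype.card_prod, Fintype.card_fin,
    Fintype.card_bool, mul_comm]
  rintro ⟨i, b⟩ ⟨j, c⟩ h
  have hi := congrFun h i
  obtain rfl : i = j := by
    by_contra hij
    simp only [Function.update_self, Function.update_of_ne hij] at hi
    exact cyclicShift_ne (by omega) _ _ hi
  simp only [Function.update_self] at hi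
  rw [cyclicShift_injective hL _ hi]

lemma card_adj_pairs {L d : ℕ} (hL : 3 ≤ L) (S : Finset (TV L d)) :
    #{p : TV L d × TV L d | p.1 ∈ S ∧ TorusAdj p.1 p.2} = 2 * d * #S := by
  rw [card_filter, Fintype.sum_prod_type]
  simp only [ite_and]
  rw [mul_comm, ← smul_eq_mul, ← sum_const, ← sum_filter_add_sum_filter_not univ (· ∈ S)]
  simp +contextual [sum_ite, card_filter_torusAdj hL]

/-- if `W∩O = ∂_ext(W∩E)` then `|∇(W)| = 2d(|W∩O| - |W∩E|)`. -/
theorem edge_boundary_size (L d : ℕ) (hL : Even L) (hL4 : 4 ≤ L)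
    (W : Set (TV L d)) (hW : oddPart W = extBdry (evenPart W)) :
    (cutsetCard L d W : ℤ) =
      2 * (d : ℤ) * ((Nat.card ↥(oddPart W) : ℤ) - (Nat.card ↥(evenPart W) : ℤ)) := by
  classical
  have hL3 : 3 ≤ L := by omega
  have hodd := card_adj_pairs hL3 (univ.filter (· ∈ oddPart W))
  have heven := card_adj_pairs hL3 (univ.filter (· ∈ evenPart W))
  have hnbr : ∀ x y, x ∈ evenPart W → TorusAdj x y → y ∈ oddPart W := by
    intro x y hx h
    rw [hW]
    exact ⟨fun hy => (h.isEvenVtx_iff hL).1 hx.2 hy.2, x, hx, h.symm⟩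
  have hcut : cutsetCard L d W =
      #{p : TV L d × TV L d | p.1 ∈ oddPart W ∧ TorusAdj p.1 p.2 ∧ p.2 ∉ evenPart W} := by
    rw [cutsetCard, Nat.card_eq_fintype_card, Fintype.card_subtype]
    congr 1
    ext ⟨x, y⟩
    simp only [mem_filter, mem_univ, true_and]
    constructor
    · rintro ⟨hx, hy, h⟩
      exact ⟨⟨hx, fun he => hy (hnbr x y ⟨hx, he⟩ h).1⟩, h, fun hy' => hy hy'.1⟩
    · rintro ⟨hx, h, hy⟩
      exact ⟨hx.1, fun hy' => hy ⟨hy', (h.symm.isEvenVtx_iff hL).2 hx.2⟩, h⟩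
  have hswap : #{p : TV L d × TV L d | p.1 ∈ evenPart W ∧ TorusAdj p.1 p.2} =
      #{p : TV L d × TV L d | p.1 ∈ oddPart W ∧ TorusAdj p.1 p.2 ∧ p.2 ∈ evenPart W} := by
    refine card_equiv (Equiv.prodComm _ _) ?_
    rintro ⟨x, y⟩
    simp only [mem_filter, mem_univ, true_and, Equiv.prodComm_apply, Prod.swap_prod_mk]
    exact ⟨fun ⟨hx, h⟩ => ⟨hnbr x y hx h, h.symm, hx⟩, fun ⟨_, h, hx⟩ => ⟨hx, h.symm⟩⟩
  have hsplit := card_filter_add_card_filter_not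
    (s := ({p : TV L d × TV L d | p.1 ∈ oddPart W ∧ TorusAdj p.1 p.2} : Finset _))
    (fun p => p.2 ∈ evenPart W)
  simp only [filter_filter, and_assoc] at hsplit
  simp only [mem_filter, mem_univ, true_and] at hodd heven
  rw [← hcut, ← hswap, hodd, heven] at hsplit
  rw [Nat.card_eq_fintype_card, Nat.card_eq_fintype_card, Fintype.card_subtype,
    Fintype.card_subtype, mul_sub]
  have hcast := congrArg (Nat.cast : ℕ → ℤ) hsplit
  push_cast at hcast
  linarith
end

section
/- There is a constant d0 > 0 such that for all d ≥ d0 and even L ≥ 4 the following holds. Let (W, γ) be a standard even cutset of a proper 3-coloring χ of T_{L,d}, set w_e = |W∩E| and w_o = |W∩O|, let A be an approximation of (W, γ), and set Q^E = (A∩E) ∩ ∂_ext(O ∖ (A∩O)) and Q^O = (O ∖ (A∩O)) ∩ ∂_ext(A∩E). Then there exists a direction s ∈ {±1,…,±d} such that |W^s| ≥ 0.8 (w_o − w_e) and |σ_s(Q^E) ∩ Q^O| ≤ 5 |W^s| / √d. -/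
open Finset

/-- A standard even cutset of a proper 3-coloring `χ`, given by its interior `W`
(with `γ = ∇(W)`): `∂_int W ⊆ O`, `∂_ext W ⊆ E`, the boundary is 0-free,
`W∩O = ∂_ext(W∩E)`, `W∩E = {y ∈ E : ∂y ⊆ W∩O}`, and
`|γ| ≥ max{|W|^{1-1/d}, d^{1.9}}`. -/
def StandardEvenCutset (L d : ℕ) (χ : TV L d → Fin 3) (W : Set (TV L d)) : Prop :=
  (∀ x ∈ intBdry W, ¬ IsEvenVtx x) ∧
  (∀ x ∈ extBdry W, IsEvenVtx x) ∧
  (∀ x ∈ intBdry W ∪ extBdry W, χ x ≠ 0) ∧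
  oddPart W = extBdry (evenPart W) ∧
  evenPart W = {y | IsEvenVtx y ∧ ∀ z, TorusAdj y z → z ∈ oddPart W} ∧
  max ((Nat.card ↥W : ℝ) ^ (1 - 1 / (d : ℝ))) ((d : ℝ) ^ (1.9 : ℝ)) ≤ (cutsetCard L d W : ℝ)

/-- `A` is an approximation of the cutset with interior `W`:
`A∩E ⊇ W∩E`, `A∩O ⊆ W∩O`, every vertex of `A∩E` has at least `2d - √d` neighbours
in `A∩O`, and every vertex of `O ∖ (A∩O)` has at least `2d - √d` neighbours in
`E ∖ (A∩E)`. -/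
def IsApproximation (L d : ℕ) (A W : Set (TV L d)) : Prop :=
  evenPart W ⊆ evenPart A ∧
  oddPart A ⊆ oddPart W ∧
  (∀ x ∈ A, IsEvenVtx x →
    2 * (d : ℝ) - Real.sqrt d ≤
      (Nat.card {y : TV L d // TorusAdj x y ∧ y ∈ A ∧ ¬ IsEvenVtx y} : ℝ)) ∧
  (∀ y : TV L d, ¬ IsEvenVtx y → y ∉ A →
    2 * (d : ℝ) - Real.sqrt d ≤
      (Nat.card {x : TV L d // TorusAdj y x ∧ IsEvenVtx x ∧ x ∉ A} : ℝ))

/-- Add one (mod `L`) in `Fin L`. -/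
def fSucc {L : ℕ} (a : Fin L) : Fin L :=
  ⟨((a : ℕ) + 1) % L, Nat.mod_lt _ (Nat.lt_of_le_of_lt (Nat.zero_le _) a.isLt)⟩

/-- Subtract one (mod `L`) in `Fin L`. -/
def fPred {L : ℕ} (a : Fin L) : Fin L :=
  ⟨((a : ℕ) + (L - 1)) % L, Nat.mod_lt _ (Nat.lt_of_le_of_lt (Nat.zero_le _) a.isLt)⟩

/-- The shift `σ_s` in direction `s`: a direction is a coordinate `s.1` together with
a sign `s.2` (`true` is the positive direction). -/
def dirShift {L d : ℕ} (s : Fin d × Bool) (x : TV L d) : TV L d :=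
  fun j => if j = s.1 then (if s.2 then fSucc (x j) else fPred (x j)) else x j

/-- The direction `-s`. -/
def negDir {d : ℕ} (s : Fin d × Bool) : Fin d × Bool := (s.1, !s.2)

/-- `W^s = {x ∈ ∂_int W : σ_{-s}(x) ∉ W}`. -/
def sideSet {L d : ℕ} (W : Set (TV L d)) (s : Fin d × Bool) : Set (TV L d) :=
  {x | x ∈ intBdry W ∧ dirShift (negDir s) x ∉ W}

/-- `Q^E = (A∩E) ∩ ∂_ext(O ∖ (A∩O))`. -/
def QEset (L d : ℕ) (A : Set (TV L d)) : Set (TV L d) :=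
  {x | (x ∈ A ∧ IsEvenVtx x) ∧ x ∈ extBdry {y : TV L d | ¬ IsEvenVtx y ∧ y ∉ A}}

/-- `Q^O = (O ∖ (A∩O)) ∩ ∂_ext(A∩E)`. -/
def QOset (L d : ℕ) (A : Set (TV L d)) : Set (TV L d) :=
  {y | (¬ IsEvenVtx y ∧ y ∉ A) ∧ y ∈ extBdry (evenPart A)}

section Shift

variable {L d : ℕ}

theorem val_fSucc (a : Fin L) :
    ((fSucc a : ℕ) = a + 1 ∧ (a : ℕ) + 1 < L) ∨ ((fSucc a : ℕ) = 0 ∧ (a : ℕ) + 1 = L) := by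
  have ha := a.isLt
  rcases Nat.lt_or_ge ((a : ℕ) + 1) L with h | h
  · exact Or.inl ⟨Nat.mod_eq_of_lt h, h⟩
  · have h' : (a : ℕ) + 1 = L := by omega
    exact Or.inr ⟨by simp [fSucc, h'], h'⟩

theorem val_fPred (a : Fin L) :
    ((fPred a : ℕ) + 1 = a) ∨ ((a : ℕ) = 0 ∧ (fPred a : ℕ) + 1 = L) := by
  have ha := a.isLt
  rcases Nat.eq_zero_or_pos (a : ℕ) with h | h
  · refine Or.inr ⟨h, ?_⟩
    have : (fPred a : ℕ) = L - 1 := by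
      simp only [fPred, h, zero_add]
      exact Nat.mod_eq_of_lt (by omega)
    omega
  · left
    have : (fPred a : ℕ) = a - 1 := by
      have e : (a : ℕ) + (L - 1) = (a - 1) + L := by omega
      simp only [fPred, e, Nat.add_mod_right]
      exact Nat.mod_eq_of_lt (by omega)
    omega

theorem fPred_fSucc (a : Fin L) : fPred (fSucc a) = a := by
  have := val_fSucc a
  have := val_fPred (fSucc a)
  have := (fPred (fSucc a)).isLt
  exact Fin.ext (by omega)

theorem fSucc_fPred (a : Fin L) : fSucc (fPred a) = a := by
  have := val_fPred a
  have := val_fSucc (fPred a)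
  have := a.isLt
  exact Fin.ext (by omega)

theorem negDir_negDir (s : Fin d × Bool) : negDir (negDir s) = s := by
  simp [negDir]

theorem dirShift_negDir (s : Fin d × Bool) (x : TV L d) :
    dirShift s (dirShift (negDir s) x) = x := by
  funext j
  rcases s with ⟨i, b⟩
  by_cases h : j = i <;> cases b <;> simp [dirShift, negDir, h, fPred_fSucc, fSucc_fPred]

theorem negDir_dirShift (s : Fin d × Bool) (x : TV L d) :
    dirShift (negDir s) (dirShift s x) = x := by
  simpa only [negDir_negDir] using dirShift_negDir (negDir s) x

theorem dirShift_injective (s : Fin d × Bool) :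
    Function.Injective (dirShift s : TV L d → TV L d) :=
  Function.LeftInverse.injective (negDir_dirShift s)

theorem torusAdj_dirShift (hL : 2 ≤ L) (s : Fin d × Bool) (x : TV L d) :
    TorusAdj x (dirShift s x) := by
  rcases s with ⟨i, b⟩
  refine ⟨i, ?_, ?_, fun j hj => by simp [dirShift, hj]⟩
  · intro h
    have h' := congrArg Fin.val h
    have := val_fSucc (x i)
    have := val_fPred (x i)
    cases b <;> simp [dirShift] at h' <;> omega
  · cases b
    · right
      have h := congrArg Fin.val (fSucc_fPred (x i))
      simpa [dirShift, fSucc] using h.symm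
    · left
      simp [dirShift, fSucc]

theorem TorusAdj.exists_dirShift {x y : TV L d} (h : TorusAdj x y) :
    ∃ s : Fin d × Bool, dirShift s x = y := by
  obtain ⟨i, -, h | h, hj⟩ := h
  · refine ⟨(i, true), funext fun j => ?_⟩
    by_cases hji : j = i
    · subst hji
      simp only [dirShift, if_true]
      exact Fin.ext h.symm
    · simpa [dirShift, hji] using hj j hji
  · refine ⟨(i, false), funext fun j => ?_⟩
    by_cases hji : j = i
    · subst hji
      have hx : x j = fSucc (y j) := Fin.ext h
      simp [dirShift, hx, fPred_fSucc]
    · simpa [dirShift, hji] using hj j hji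

theorem isEvenVtx_dirShift (hL : Even L) (s : Fin d × Bool) (x : TV L d) :
    IsEvenVtx (dirShift s x) ↔ ¬ IsEvenVtx x := by
  rcases s with ⟨i, b⟩
  unfold IsEvenVtx
  rw [← Finset.add_sum_erase _ _ (Finset.mem_univ i),
    ← Finset.add_sum_erase univ (fun j => (x j : ℕ)) (Finset.mem_univ i)]
  have hs : ∑ j ∈ univ.erase i, (dirShift (i, b) x j : ℕ) = ∑ j ∈ univ.erase i, (x j : ℕ) :=
    Finset.sum_congr rfl fun j hj => by simp [dirShift, Finset.ne_of_mem_erase hj]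
  rw [hs]
  obtain ⟨k, hk⟩ := hL
  have := val_fSucc (x i)
  have := val_fPred (x i)
  have := (x i).isLt
  cases b <;> simp [dirShift] <;> omega

/-- The number of neighbours with a given property is at most the number of directions
leading to such a neighbour. -/
theorem card_torusAdj_le (x : TV L d) (P : TV L d → Prop) :
    Nat.card {y : TV L d // TorusAdj x y ∧ P y} ≤
      Nat.card {s : Fin d × Bool // P (dirShift s x)} := by
  choose f hf using fun y : {y : TV L d // TorusAdj x y ∧ P y} => y.2.1.exists_dirShift
  refine Nat.card_le_card_of_injective
    (fun y => (⟨f y, by rw [hf y]; exact y.2.2⟩ : {s : Fin d × Bool // P (dirShift s x)})) ?_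
  intro y z hyz
  have h : f y = f z := congrArg Subtype.val hyz
  exact Subtype.ext (by rw [← hf y, ← hf z, h])

theorem card_negDir_eq (Q : Fin d × Bool → Prop) :
    Nat.card {s // Q (negDir s)} = Nat.card {s // Q s} :=
  Nat.card_congr
    ((Function.Involutive.toPerm negDir negDir_negDir).subtypeEquiv fun _ => Iff.rfl)

theorem card_dir_add_compl (P : Fin d × Bool → Prop) :
    (Nat.card {s // P s} : ℝ) + (Nat.card {s // ¬ P s} : ℝ) = 2 * d := by
  classical
  have h := Fintype.card_subtype_compl P
  have h' := Fintype.card_subtype_le P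
  have hc : Fintype.card (Fin d × Bool) = d * 2 := by simp
  rw [Nat.card_eq_fintype_card, Nat.card_eq_fintype_card, h, Nat.cast_sub h', hc]
  push_cast
  ring

end Shift

/-- Double counting: if for each `x ∈ N` at most `a` of the `s` satisfy `P x s` and at least `b`
satisfy `R x s`, the incidences of `P` are at most `a / b` times those of `R`. -/
theorem mul_sum_ncard_le_mul_sum_ncard {X S : Type*} [Finite X] [Fintype S] (N : Set X)
    (P R : X → S → Prop) {a b : ℝ} (ha : 0 ≤ a) (hb : 0 ≤ b)
    (hP : ∀ x ∈ N, (Nat.card {s // P x s} : ℝ) ≤ a)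
    (hR : ∀ x ∈ N, b ≤ (Nat.card {s // R x s} : ℝ)) :
    b * ∑ s, ({x | x ∈ N ∧ P x s}.ncard : ℝ) ≤ a * ∑ s, ({x | x ∈ N ∧ R x s}.ncard : ℝ) := by
  classical
  have := Fintype.ofFinite X
  have swap : ∀ Q : X → S → Prop, ∑ s, ({x | x ∈ N ∧ Q x s}.ncard : ℝ) =
      ∑ x with x ∈ N, (Nat.card {s // Q x s} : ℝ) := by
    intro Q
    have h := Finset.sum_card_bipartiteAbove_eq_sum_card_bipartiteBelow Q
      (s := univ.filter (· ∈ N)) (t := univ)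
    have h1 : ∀ s, {x | x ∈ N ∧ Q x s}.ncard =
        #((univ.filter (· ∈ N)).bipartiteBelow Q s) := by
      intro s
      rw [← Set.ncard_coe_finset]
      congr 1
      ext x
      simp
    have h2 : ∀ x, Nat.card {s // Q x s} = #((univ : Finset S).bipartiteAbove Q x) := by
      intro x
      rw [Nat.card_eq_fintype_card, Fintype.card_subtype]
      rfl
    simp only [h1, h2]
    exact_mod_cast h.symm
  rw [swap, swap]
  calc b * ∑ x with x ∈ N, (Nat.card {s // P x s} : ℝ)
      ≤ b * ∑ x with x ∈ N, a := by
        gcongr with x hx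
        exact hP x (by simpa using hx)
    _ = a * ∑ x with x ∈ N, b := by
        simp only [Finset.sum_const, nsmul_eq_mul]
        ring
    _ ≤ _ := by
        gcongr with x hx
        exact hR x (by simpa using hx)

section Cutset

variable {L d : ℕ} {A W : Set (TV L d)}

/-- All sides of a cutset with odd interior boundary have the same size. -/
theorem card_sideSet_add (hE : Even L) (hL : 2 ≤ L) (h1 : ∀ x ∈ intBdry W, ¬ IsEvenVtx x)
    (s : Fin d × Bool) :
    (sideSet W s).ncard + (evenPart W).ncard = (oddPart W).ncard := by
  have hmem : ∀ x ∈ W, IsEvenVtx x → ∀ t, dirShift t x ∈ W := fun x hx hxe t => by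
    by_contra h
    exact h1 x ⟨hx, _, h, torusAdj_dirShift hL t x⟩ hxe
  have hsub : dirShift s '' evenPart W ⊆ oddPart W := by
    rintro _ ⟨x, ⟨hx, hxe⟩, rfl⟩
    exact ⟨hmem x hx hxe s, by simpa [isEvenVtx_dirShift hE] using hxe⟩
  have heq : sideSet W s = oddPart W \ (dirShift s '' evenPart W) := by
    ext x
    constructor
    · rintro ⟨hx, hs⟩
      refine ⟨⟨hx.1, h1 x hx⟩, ?_⟩
      rintro ⟨y, hy, rfl⟩
      exact hs (by rw [negDir_dirShift]; exact hy.1)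
    · rintro ⟨⟨hx, hxo⟩, hs⟩
      have : dirShift (negDir s) x ∉ W := fun h =>
        hs ⟨_, ⟨h, (isEvenVtx_dirShift hE _ _).2 hxo⟩, dirShift_negDir s x⟩
      exact ⟨⟨hx, _, this, torusAdj_dirShift hL _ _⟩, this⟩
  rw [heq, ← Set.ncard_image_of_injective (evenPart W) (dirShift_injective s)]
  exact Set.ncard_sdiff_add_ncard_of_subset hsub

/-- The edges from `A ∩ E` to `O \ A` leaving from a vertex outside the interior. -/
theorem mul_sum_outer_le (hE : Even L) (hL : 2 ≤ L) (hA : IsApproximation L d A W)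
    (hd : 0 ≤ 2 * (d : ℝ) - √d) :
    (2 * (d : ℝ) - √d) * ∑ s, ({x | (x ∈ A ∧ IsEvenVtx x ∧ x ∉ W) ∧ dirShift s x ∉ A}.ncard : ℝ)
      ≤ √d * ∑ s, ((sideSet W s).ncard : ℝ) := by
  obtain ⟨-, h2, h3, -⟩ := hA
  have key : ∀ x ∈ A, IsEvenVtx x →
      2 * (d : ℝ) - √d ≤ (Nat.card {s : Fin d × Bool // dirShift s x ∈ A} : ℝ) := by
    intro x hx hxe
    refine (h3 x hx hxe).trans ?_
    have h := card_torusAdj_le x (fun y => y ∈ A ∧ ¬ IsEvenVtx y)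
    simp only [isEvenVtx_dirShift hE, hxe, not_true_eq_false, not_false_eq_true, and_true] at h
    exact_mod_cast h
  refine (mul_sum_ncard_le_mul_sum_ncard {x | x ∈ A ∧ IsEvenVtx x ∧ x ∉ W}
    (fun x s => dirShift s x ∉ A) (fun x s => dirShift s x ∈ A)
    (Real.sqrt_nonneg d) hd ?_ ?_).trans ?_
  · rintro x ⟨hx, hxe, -⟩
    have := key x hx hxe
    have := card_dir_add_compl (fun s => dirShift s x ∈ A)
    linarith
  · rintro x ⟨hx, hxe, -⟩
    exact key x hx hxe
  · refine mul_le_mul_of_nonneg_left (Finset.sum_le_sum fun s _ => Nat.cast_le.2 ?_)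
      (Real.sqrt_nonneg d)
    refine Set.ncard_le_ncard_of_injOn (dirShift s) ?_ (dirShift_injective s).injOn (Set.toFinite _)
    rintro x ⟨⟨hx, hxe, hxW⟩, hs⟩
    have hsW : dirShift s x ∈ W :=
      (h2 ⟨hs, by simpa [isEvenVtx_dirShift hE] using hxe⟩).1
    have hn : dirShift (negDir s) (dirShift s x) ∉ W := by rwa [negDir_dirShift]
    exact ⟨⟨hsW, _, hn, torusAdj_dirShift hL _ _⟩, hn⟩

/-- The edges from `A ∩ E` to `O \ A` arriving at a vertex of the interior. -/
theorem mul_sum_inner_le (hE : Even L) (hL : 2 ≤ L) (hA : IsApproximation L d A W)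
    (hd : 0 ≤ 2 * (d : ℝ) - √d) :
    (2 * (d : ℝ) - √d) *
        ∑ s, ({y | (y ∉ A ∧ ¬ IsEvenVtx y ∧ y ∈ W) ∧ dirShift (negDir s) y ∈ A}.ncard : ℝ)
      ≤ √d * ∑ s, ((sideSet W s).ncard : ℝ) := by
  obtain ⟨h1, -, -, h4⟩ := hA
  have key : ∀ y, ¬ IsEvenVtx y → y ∉ A →
      2 * (d : ℝ) - √d ≤ (Nat.card {s : Fin d × Bool // dirShift (negDir s) y ∉ A} : ℝ) := by
    intro y hyo hy
    refine (h4 y hyo hy).trans ?_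
    have h := card_torusAdj_le y (fun x => IsEvenVtx x ∧ x ∉ A)
    simp only [isEvenVtx_dirShift hE, hyo, not_false_eq_true, true_and] at h
    rw [card_negDir_eq (fun s => dirShift s y ∉ A)]
    exact_mod_cast h
  refine (mul_sum_ncard_le_mul_sum_ncard {y | y ∉ A ∧ ¬ IsEvenVtx y ∧ y ∈ W}
    (fun y s => dirShift (negDir s) y ∈ A) (fun y s => dirShift (negDir s) y ∉ A)
    (Real.sqrt_nonneg d) hd ?_ ?_).trans ?_
  · rintro y ⟨hy, hyo, -⟩
    have := key y hyo hy
    have := card_dir_add_compl (fun s => dirShift (negDir s) y ∈ A)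
    linarith
  · rintro y ⟨hy, hyo, -⟩
    exact key y hyo hy
  · gcongr with s
    · exact Set.toFinite _
    · rintro y ⟨⟨-, hyo, hyW⟩, hs⟩
      have hn : dirShift (negDir s) y ∉ W := fun h =>
        hs (h1 ⟨h, (isEvenVtx_dirShift hE _ _).2 hyo⟩).1
      exact ⟨⟨hyW, _, hn, torusAdj_dirShift hL _ _⟩, hn⟩

theorem ncard_shift_inter_le (hL : 2 ≤ L) (h1 : ∀ x ∈ intBdry W, ¬ IsEvenVtx x)
    (s : Fin d × Bool) :
    ((dirShift s '' QEset L d A) ∩ QOset L d A).ncard ≤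
      {x | (x ∈ A ∧ IsEvenVtx x ∧ x ∉ W) ∧ dirShift s x ∉ A}.ncard +
        {y | (y ∉ A ∧ ¬ IsEvenVtx y ∧ y ∈ W) ∧ dirShift (negDir s) y ∈ A}.ncard := by
  rw [← Set.ncard_image_of_injective
    {x | (x ∈ A ∧ IsEvenVtx x ∧ x ∉ W) ∧ dirShift s x ∉ A} (dirShift_injective s)]
  refine (Set.ncard_le_ncard ?_ (Set.toFinite _)).trans (Set.ncard_union_le _ _)
  rintro _ ⟨⟨x, ⟨⟨hx, hxe⟩, -⟩, rfl⟩, ⟨hyo, hy⟩, -⟩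
  by_cases hxW : x ∈ W
  · refine Or.inr ⟨⟨hy, hyo, ?_⟩, by rwa [negDir_dirShift]⟩
    by_contra h
    exact h1 x ⟨hxW, _, h, torusAdj_dirShift hL s x⟩ hxe
  · exact Or.inl ⟨x, ⟨⟨hx, hxe, hxW⟩, hy⟩, rfl⟩

end Cutset


/-- for every standard even cutset `(W,γ)` and approximation `A` of it
there is a direction `s` with `|W^s| ≥ 0.8 (w_o - w_e)` and
`|σ_s(Q^E) ∩ Q^O| ≤ 5 |W^s| / √d`. -/
theorem good_direction_exists :
    ∃ d0 : ℕ, 0 < d0 ∧ ∀ d L : ℕ, d0 ≤ d → Even L → 4 ≤ L →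
      ∀ χ : TV L d → Fin 3, ProperColoring L d χ →
      ∀ W : Set (TV L d), StandardEvenCutset L d χ W →
      ∀ A : Set (TV L d), IsApproximation L d A W →
        ∃ s : Fin d × Bool,
          (0.8 : ℝ) * ((Nat.card ↥(oddPart W) : ℝ) - (Nat.card ↥(evenPart W) : ℝ)) ≤
              (Nat.card ↥(sideSet W s) : ℝ) ∧
          (Nat.card ↥((dirShift s '' QEset L d A) ∩ QOset L d A) : ℝ) ≤
            5 * (Nat.card ↥(sideSet W s) : ℝ) / Real.sqrt d := by
  refine ⟨1, one_pos, fun d L hd hE hL χ _ W hW A hA => ?_⟩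
  have hL2 : 2 ≤ L := by omega
  have h1 := hW.1
  simp only [Nat.card_coe_set_eq]
  have hside : ∀ s : Fin d × Bool,
      ((sideSet W s).ncard : ℝ) = (oddPart W).ncard - (evenPart W).ncard := fun s => by
    rw [eq_sub_iff_add_eq]
    exact_mod_cast card_sideSet_add hE hL2 h1 s
  have hd1 : (1 : ℝ) ≤ d := by exact_mod_cast hd
  have hr1 : 1 ≤ √(d : ℝ) := Real.one_le_sqrt.2 hd1
  have hr : √(d : ℝ) * √(d : ℝ) = d := Real.mul_self_sqrt (by positivity)
  have hdr : (d : ℝ) ≤ 2 * (d : ℝ) - √d := by nlinarith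
  have hd0 : 0 ≤ 2 * (d : ℝ) - √d := by linarith
  have : Nonempty (Fin d × Bool) := ⟨(⟨0, hd⟩, true)⟩
  have hout := mul_sum_outer_le hE hL2 hA hd0
  have hin := mul_sum_inner_le hE hL2 hA hd0
  simp only [hside] at hout hin ⊢
  set m : ℝ := (oddPart W).ncard - (evenPart W).ncard with hm
  have hm0 : 0 ≤ m := by
    rw [← hside (Classical.arbitrary _)]
    positivity
  have hcard : ∀ c : ℝ, ∑ _s : Fin d × Bool, c = 2 * d * c := fun c => by
    simp [Finset.sum_const, mul_comm]
  rw [hcard] at hout hin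
  have hsum : ∑ s, (((dirShift s '' QEset L d A) ∩ QOset L d A).ncard : ℝ) ≤
      ∑ _s : Fin d × Bool, 5 * m / √d := by
    have hle : ∑ s, (((dirShift s '' QEset L d A) ∩ QOset L d A).ncard : ℝ) ≤ _ :=
      Finset.sum_le_sum fun s _ =>
        (Nat.cast_le (α := ℝ)).2 (ncard_shift_inter_le (A := A) hL2 h1 s)
    simp only [Nat.cast_add, Finset.sum_add_distrib] at hle
    refine hle.trans ?_
    rw [hcard, ← mul_div_assoc, le_div_iff₀ (by positivity)]
    set T := ∑ s : Fin d × Bool,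
      ({x | (x ∈ A ∧ IsEvenVtx x ∧ x ∉ W) ∧ dirShift s x ∉ A}.ncard : ℝ)
    set U := ∑ s : Fin d × Bool,
      ({y | (y ∉ A ∧ ¬ IsEvenVtx y ∧ y ∈ W) ∧ dirShift (negDir s) y ∈ A}.ncard : ℝ)
    have hTU : 0 ≤ T + U := by positivity
    have hmul : (d : ℝ) * (T + U) ≤ d * (4 * √d * m) := by
      have := mul_le_mul_of_nonneg_right hdr hTU
      linarith
    have hbound := le_of_mul_le_mul_left hmul (by linarith)
    calc (T + U) * √d ≤ 4 * √d * m * √d := by gcongr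
      _ = 4 * (d * m) := by linear_combination 4 * m * hr
      _ ≤ 2 * d * (5 * m) := by nlinarith [mul_nonneg (by linarith : (0 : ℝ) ≤ d) hm0]
  obtain ⟨s, -, hs⟩ := Finset.exists_le_of_sum_le Finset.univ_nonempty hsum
  exact ⟨s, by linarith, hs⟩
end
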